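/- Let K be a field and let A and B be Wedderburn K-algebras (for each, the Jacobson radical is nilpotent and the quotient by it is a separable K-algebra). Then A ⊗[K] B is a Wedderburn K-algebra, and its Jacobson radical J(A ⊗[K] B) equals the sum of the images of J(A) ⊗[K] B and A ⊗[K] J(B) in A ⊗[K] B. -/

import Mathlib

open TensorProduct

universe u v

/-- A subset `S` of a (possibly noncommutative) ring is *nilpotent* if there is an `n ≥ 1`
such that every product of `n` elements of `S` vanishes. -/
def IsNilpotentSet {R : Type*} [Ring R] (S : Set R) : Prop :=
  ∃ n : ℕ, 0 < n ∧ ∀ l : List R, (∀ x ∈ l, x ∈ S) → l.length = n → l.prod = 0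

/-- A `K`-algebra `B` is *separable* (or absolutely semisimple) if `L ⊗[K] B` is a
semisimple ring for every field extension `L/K`. -/
def IsSeparableKAlgebra (K : Type u) [Field K] (B : Type v) [Ring B] [Algebra K B] : Prop :=
  ∀ (L : Type u) [Field L] [Algebra K L], IsSemisimpleRing (TensorProduct K L B)

/-- The relation on a ring identifying two elements whose difference lies in the Jacobson
radical (the intersection of the maximal left ideals). -/
def jacRel (A : Type*) [Ring A] : A → A → Prop :=
  fun a b => a - b ∈ Ideal.jacobson (⊥ : Ideal A)

/-- The quotient of a ring by its Jacobson radical (which is a two-sided ideal), realized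
as a `RingQuot`. -/
abbrev JacQuot (A : Type*) [Ring A] := RingQuot (jacRel A)

section Nilpotent

variable {K A B C : Type*} [Field K] [Ring A] [Algebra K A] [Ring B] [Algebra K B]
  [Ring C] [Algebra K C]

theorem IsNilpotentSet.exists_pow_eq_bot {M : Submodule K A} (h : IsNilpotentSet (M : Set A)) :
    ∃ n : ℕ, M ^ n = ⊥ := by
  obtain ⟨n, -, hn⟩ := h
  refine ⟨n, ?_⟩
  rw [Submodule.pow_eq_span_pow_set, Submodule.span_eq_bot]
  intro x hx
  obtain ⟨f, rfl⟩ := Set.mem_pow.mp hx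
  refine hn _ (fun x hx => ?_) (by simp)
  obtain ⟨i, rfl⟩ := List.mem_ofFn.mp hx
  exact (f i).2

theorem Submodule.list_prod_mem_pow (M : Submodule K A) (l : List A) (hl : ∀ x ∈ l, x ∈ M) :
    l.prod ∈ M ^ l.length := by
  induction l with
  | nil => simp [Submodule.one_le.mp le_rfl]
  | cons a l ih =>
    rw [List.prod_cons, List.length_cons, pow_succ']
    exact Submodule.mul_mem_mul (hl a (by simp)) (ih fun x hx => hl x (by simp [hx]))

theorem Submodule.isNilpotentSet_of_pow_eq_bot {M : Submodule K A} {n : ℕ} (h : M ^ n = ⊥) :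
    IsNilpotentSet (M : Set A) := by
  refine ⟨n + 1, n.succ_pos, fun l hl hn => ?_⟩
  have := M.list_prod_mem_pow l hl
  rwa [hn, pow_succ, h, Submodule.bot_mul, Submodule.mem_bot] at this

theorem AlgHom.exists_ker_comp_pow_eq_bot (f : A →ₐ[K] B) (g : B →ₐ[K] C)
    (hf : ∃ n : ℕ, LinearMap.ker f.toLinearMap ^ n = ⊥)
    (hg : ∃ n : ℕ, LinearMap.ker g.toLinearMap ^ n = ⊥) :
    ∃ n : ℕ, LinearMap.ker (g.comp f).toLinearMap ^ n = ⊥ := by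
  obtain ⟨n, hn⟩ := hf
  obtain ⟨m, hm⟩ := hg
  refine ⟨m * n, ?_⟩
  rw [pow_mul, eq_bot_iff, ← hn]
  refine pow_le_pow_left' ?_ n
  rw [← Submodule.comap_bot f.toLinearMap, ← Submodule.map_le_iff_le_comap, Submodule.map_pow, ← hm]
  refine pow_le_pow_left' ?_ m
  rintro _ ⟨x, hx, rfl⟩
  simpa using hx

theorem Submodule.exists_range_rTensor_pow_eq_bot (M : Submodule K A)
    (h : ∃ n : ℕ, M ^ n = ⊥) :
    ∃ n : ℕ, LinearMap.range (LinearMap.rTensor B M.subtype) ^ n = ⊥ := by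
  obtain ⟨n, hn⟩ := h
  have key (k : ℕ) : LinearMap.range (LinearMap.rTensor B M.subtype) ^ (k + 1) ≤
      LinearMap.range (LinearMap.rTensor B (M ^ (k + 1)).subtype) := by
    induction k with
    | zero => rw [zero_add, pow_one, pow_one]
    | succ k ih =>
      rw [pow_succ]
      refine (mul_le_mul_left ih _).trans (Submodule.mul_le.mpr ?_)
      rintro _ ⟨x, rfl⟩ _ ⟨y, rfl⟩
      induction x with
      | zero => simp
      | add x x' hx hx' => rw [map_add, add_mul]; exact add_mem hx hx'
      | tmul a b =>
        induction y with
        | zero => simp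
        | add y y' hy hy' => rw [map_add, mul_add]; exact add_mem hy hy'
        | tmul a' b' =>
          exact ⟨⟨a * a', pow_succ M (k + 1) ▸ Submodule.mul_mem_mul a.2 a'.2⟩ ⊗ₜ (b * b'),
            by simp⟩
  refine ⟨n + 1, eq_bot_iff.mpr ((key n).trans ?_)⟩
  rw [pow_succ, hn, Submodule.bot_mul]
  rintro _ ⟨x, rfl⟩
  rw [Submodule.mem_bot]
  induction x with
  | zero => simp
  | add x y hx hy => rw [map_add, hx, hy, add_zero]
  | tmul a b => simp [(Submodule.mem_bot K).mp a.2]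

theorem AlgHom.exists_ker_rTensor_pow_eq_bot (B : Type*) [Ring B] [Algebra K B]
    (f : A →ₐ[K] C) (hf : ∃ n : ℕ, LinearMap.ker f.toLinearMap ^ n = ⊥) :
    ∃ n : ℕ, LinearMap.ker (Algebra.TensorProduct.map f (AlgHom.id K B)).toLinearMap ^ n = ⊥ := by
  have h : LinearMap.ker (Algebra.TensorProduct.map f (AlgHom.id K B)).toLinearMap =
      LinearMap.range (LinearMap.rTensor B (LinearMap.ker f.toLinearMap).subtype) :=
    (LinearMap.exact_subtype_ker_map f.toLinearMap |> Module.Flat.rTensor_exact B).linearMap_ker_eq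
  rw [h]
  exact Submodule.exists_range_rTensor_pow_eq_bot _ hf

theorem AlgHom.exists_ker_lTensor_pow_eq_bot (B : Type*) [Ring B] [Algebra K B]
    (f : A →ₐ[K] C) (hf : ∃ n : ℕ, LinearMap.ker f.toLinearMap ^ n = ⊥) :
    ∃ n : ℕ, LinearMap.ker (Algebra.TensorProduct.map (AlgHom.id K B) f).toLinearMap ^ n = ⊥ := by
  have h : Algebra.TensorProduct.map (AlgHom.id K B) f =
      ((Algebra.TensorProduct.comm K C B : C ⊗[K] B →ₐ[K] B ⊗[K] C).comp
        (Algebra.TensorProduct.map f (AlgHom.id K B))).comp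
        (Algebra.TensorProduct.comm K B A : B ⊗[K] A →ₐ[K] A ⊗[K] B) := by
    ext <;> simp
  rw [h]
  refine AlgHom.exists_ker_comp_pow_eq_bot _ _ ?_ (AlgHom.exists_ker_comp_pow_eq_bot _ _
    (f.exists_ker_rTensor_pow_eq_bot B hf) ?_)
  all_goals
    refine ⟨1, ?_⟩
    rw [pow_one, LinearMap.ker_eq_bot]
    exact AlgEquiv.injective _

/-- The kernel of a ring homomorphism with nilpotent kernel lies in the Jacobson radical. -/
theorem AlgHom.ker_le_jacobson (f : A →ₐ[K] C)
    (hf : ∃ n : ℕ, LinearMap.ker f.toLinearMap ^ n = ⊥) {x : A} (hx : f x = 0) :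
    x ∈ Ideal.jacobson (⊥ : Ideal A) := by
  obtain ⟨n, hn⟩ := hf
  refine Ideal.mem_jacobson_iff.mpr fun y => ?_
  have hyx : IsNilpotent (y * x) := by
    refine ⟨n, (Submodule.mem_bot K).mp ?_⟩
    rw [← hn]
    exact Submodule.pow_mem_pow _ (by simp [hx]) n
  obtain ⟨u, hu⟩ := hyx.isUnit_add_one
  refine ⟨↑u⁻¹, ?_⟩
  rw [Ideal.mem_bot, mul_assoc, ← mul_add_one, ← hu, Units.inv_mul, sub_self]

theorem AlgHom.mem_jacobson_iff_of_isSemisimpleRing (f : A →ₐ[K] C) (hs : Function.Surjective f)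
    [IsSemisimpleRing C] (hf : ∃ n : ℕ, LinearMap.ker f.toLinearMap ^ n = ⊥) {x : A} :
    x ∈ Ideal.jacobson (⊥ : Ideal A) ↔ f x = 0 := by
  refine ⟨fun hx => ?_, f.ker_le_jacobson hf⟩
  rw [Ideal.jacobson_bot] at hx
  have : RingHomSurjective (f : A →+* C) := ⟨hs⟩
  have := Ring.le_comap_jacobson (f : A →+* C) hx
  rwa [IsSemisimpleRing.jacobson_eq_bot] at this

theorem mkAlgHom_jacRel_eq_zero_iff (x : A) :
    RingQuot.mkAlgHom K (jacRel A) x = 0 ↔ x ∈ Ideal.jacobson (⊥ : Ideal A) := by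
  constructor
  · intro h
    let g : A →ₐ[K] A ⧸ Ideal.jacobson (⊥ : Ideal A) := Ideal.Quotient.mkₐ K _
    have hg : ∀ ⦃x y⦄, jacRel A x y → g x = g y := fun x y hxy => Ideal.Quotient.eq.mpr hxy
    have := congrArg (RingQuot.liftAlgHom K ⟨g, hg⟩) h
    rw [RingQuot.liftAlgHom_mkAlgHom_apply, map_zero] at this
    exact Ideal.Quotient.eq_zero_iff_mem.mp this
  · intro h
    have : jacRel A x 0 := by simpa [jacRel] using h
    simpa using RingQuot.mkAlgHom_rel K this

theorem ker_mkAlgHom_jacRel : LinearMap.ker (RingQuot.mkAlgHom K (jacRel A)).toLinearMap =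
    (Ideal.jacobson (⊥ : Ideal A)).restrictScalars K :=
  SetLike.ext mkAlgHom_jacRel_eq_zero_iff

/-- If the kernel of a surjection `A → C` is the Jacobson radical, then `C` is the quotient of `A`
by its Jacobson radical. -/
theorem nonempty_jacQuot_algEquiv (f : A →ₐ[K] C) (hs : Function.Surjective f)
    (hf : ∀ x, x ∈ Ideal.jacobson (⊥ : Ideal A) ↔ f x = 0) : Nonempty (JacQuot A ≃ₐ[K] C) := by
  have hg : ∀ ⦃x y⦄, jacRel A x y → f x = f y := fun x y hxy =>
    sub_eq_zero.mp (by rw [← map_sub]; exact (hf _).mp hxy)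
  refine ⟨AlgEquiv.ofBijective (RingQuot.liftAlgHom K ⟨f, hg⟩) ⟨?_, fun y => ?_⟩⟩
  · rw [injective_iff_map_eq_zero]
    intro a ha
    obtain ⟨a, rfl⟩ := RingQuot.mkAlgHom_surjective K (jacRel A) a
    rw [RingQuot.liftAlgHom_mkAlgHom_apply] at ha
    exact (mkAlgHom_jacRel_eq_zero_iff a).mpr ((hf a).mpr ha)
  · obtain ⟨x, rfl⟩ := hs y
    exact ⟨RingQuot.mkAlgHom K _ x, RingQuot.liftAlgHom_mkAlgHom_apply K f hg x⟩

end Nilpotent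

section Separable

variable {K : Type u} [Field K]

open Polynomial in
/-- If `K(X) ⊗[K] B` is left artinian, then every element of `B` is algebraic over `K`. -/
theorem Algebra.IsIntegral.of_isArtinianRing_fractionRing_tensorProduct {B : Type*} [Ring B]
    [Algebra K B] [IsArtinianRing (FractionRing K[X] ⊗[K] B)] : Algebra.IsIntegral K B := by
  refine ⟨fun b => ?_⟩
  let F := FractionRing K[X]
  let φ : B[X] →ₐ[K] F ⊗[K] B :=
    ((Algebra.TensorProduct.map (IsScalarTower.toAlgHom K K[X] F) (AlgHom.id K B)).comp
      (Algebra.TensorProduct.comm K B K[X] : B ⊗[K] K[X] →ₐ[K] K[X] ⊗[K] B)).comp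
      (polyEquivTensor K B : B[X] →ₐ[K] B ⊗[K] K[X])
  have hφ : Function.Injective φ :=
    ((Module.Flat.rTensor_preserves_injective_linearMap (M := B)
      (IsScalarTower.toAlgHom K K[X] F).toLinearMap
      (IsFractionRing.injective K[X] F)).comp
      (Algebra.TensorProduct.comm K B K[X]).injective).comp (polyEquivTensor K B).injective
  have hmap (p : K[X]) : φ (p.map (algebraMap K B)) = algebraMap K[X] F p ⊗ₜ 1 := by
    have : φ.comp (mapAlgHom (Algebra.ofId K B)) =
        Algebra.TensorProduct.includeLeft.comp (IsScalarTower.toAlgHom K K[X] F) := by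
      ext
      simp [φ, polyEquivTensor_apply]
    exact DFunLike.congr_fun this p
  have hden (z : F ⊗[K] B) : ∃ p : K[X], p ≠ 0 ∧ ∃ q : B[X],
      φ q = φ (p.map (algebraMap K B)) * z := by
    induction z with
    | zero => exact ⟨1, one_ne_zero, 0, by simp⟩
    | add x y hx hy =>
      obtain ⟨p, hp, q, hq⟩ := hx
      obtain ⟨p', hp', q', hq'⟩ := hy
      refine ⟨p * p', mul_ne_zero hp hp',
        p'.map (algebraMap K B) * q + p.map (algebraMap K B) * q', ?_⟩
      rw [map_add, map_mul, map_mul, hq, hq', ← mul_assoc, ← mul_assoc, mul_add]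
      simp only [hmap, Algebra.TensorProduct.tmul_mul_tmul, map_mul, mul_one]
      rw [mul_comm (algebraMap K[X] F p')]
    | tmul f c =>
      obtain ⟨n, d, hd, rfl⟩ := IsFractionRing.div_surjective (A := K[X]) f
      refine ⟨d, nonZeroDivisors.ne_zero hd, n.map (algebraMap K B) * C c, ?_⟩
      have hd' : algebraMap K[X] F d ≠ 0 := by
        simpa using nonZeroDivisors.ne_zero hd
      have hC : φ (C c) = 1 ⊗ₜ c := by simp [φ, polyEquivTensor_apply]
      rw [map_mul, hmap, hmap, hC, Algebra.TensorProduct.tmul_mul_tmul,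
        Algebra.TensorProduct.tmul_mul_tmul, mul_div_cancel₀ _ hd', one_mul, mul_one]
  have hunit (p : K[X]) (hp : p ≠ 0) (z : F ⊗[K] B)
      (h : φ (p.map (algebraMap K B)) * z = 0) : z = 0 := by
    have hp' : algebraMap K[X] F p ≠ 0 := by simpa using hp
    have := congrArg (((algebraMap K[X] F p)⁻¹ ⊗ₜ[K] (1 : B)) * ·) h
    simpa [hmap, ← mul_assoc, inv_mul_cancel₀ hp', ← Algebra.TensorProduct.one_def] using this
  have hinj : Function.Injective
      (LinearMap.toSpanSingleton (F ⊗[K] B) (F ⊗[K] B) (φ (X - C b))) := by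
    rw [injective_iff_map_eq_zero]
    intro z hz
    obtain ⟨p, hp, q, hq⟩ := hden z
    have hqz : φ (q * (X - C b)) = 0 := by
      rw [map_mul, hq, mul_assoc]
      exact (congrArg _ hz).trans (mul_zero _)
    have hq0 : q = 0 :=
      ((monic_X_sub_C b).isRegular.right.mul_right_eq_zero_iff).mp
        ((map_eq_zero_iff φ hφ).mp hqz)
    exact hunit p hp z (by rw [← hq, hq0, map_zero])
  obtain ⟨r, hr⟩ := IsArtinian.surjective_of_injective_endomorphism _ hinj 1
  obtain ⟨p, hp, q, hq⟩ := hden r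
  have hqp : q * (X - C b) = p.map (algebraMap K B) := hφ <| by
    rw [map_mul, hq, mul_assoc]
    exact (congrArg _ hr).trans (mul_one _)
  refine isAlgebraic_iff_isIntegral.mp ⟨p, hp, ?_⟩
  rw [aeval_def, ← eval_map, ← hqp, eval_mul_X_sub_C]

theorem IsSemisimpleRing.finite_of_isIntegral (L R : Type*) [Field L] [IsAlgClosed L] [Ring R]
    [Algebra L R] [IsSemisimpleRing R] [Algebra.IsIntegral L R] : Module.Finite L R := by
  obtain ⟨n, D, d, _, _, hd, ⟨e⟩⟩ := exists_algEquiv_pi_matrix_divisionRing L R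
  have hD (i : Fin n) : Module.Finite L (D i) := by
    have hM : Algebra.IsIntegral L (Matrix (Fin (d i)) (Fin (d i)) (D i)) :=
      Algebra.IsIntegral.of_surjective
        ((Pi.evalAlgHom L (fun i => Matrix (Fin (d i)) (Fin (d i)) (D i)) i).comp
          (e : R →ₐ[L] ∀ i, Matrix (Fin (d i)) (Fin (d i)) (D i)))
        ((Function.surjective_eval i).comp e.surjective)
    have : Algebra.IsIntegral L (D i) :=
      ⟨fun x => (isIntegral_algHom_iff (Matrix.scalarAlgHom (Fin (d i)) L)
        fun a b h => by simpa using congrFun₂ h 0 0).mp (hM.isIntegral _)⟩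
    exact .of_surjective (Algebra.linearMap L (D i))
      IsAlgClosed.algebraMap_bijective_of_isIntegral.2
  exact Module.Finite.equiv e.symm.toLinearEquiv

theorem isSemisimpleRing_tensorProduct_baseChange (L F B : Type*) [Field L] [Algebra K L]
    [Field F] [Algebra K F] [Algebra L F] [IsScalarTower K L F] [Ring B] [Algebra K B]
    [IsSemisimpleRing (F ⊗[K] B)] : IsSemisimpleRing (F ⊗[L] (L ⊗[K] B)) := by
  let e : F ⊗[L] (L ⊗[K] B) ≃ₐ[F] F ⊗[K] B :=
    (Algebra.TensorProduct.assoc K L F F L B).symm.trans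
      (Algebra.TensorProduct.congr (Algebra.TensorProduct.rid L F F) AlgEquiv.refl)
  exact e.symm.toRingEquiv.isSemisimpleRing

theorem IsSeparableKAlgebra.baseChange {B : Type u} [Ring B] [Algebra K B]
    (h : IsSeparableKAlgebra K B) (L : Type u) [Field L] [Algebra K L] :
    IsSeparableKAlgebra L (L ⊗[K] B) := by
  intro F _ _
  let : Algebra K F := ((algebraMap L F).comp (algebraMap K L)).toAlgebra
  have : IsScalarTower K L F := IsScalarTower.of_algebraMap_eq' rfl
  have := h F
  exact isSemisimpleRing_tensorProduct_baseChange L F B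

theorem IsSeparableKAlgebra.of_algEquiv {B C : Type u} [Ring B] [Algebra K B] [Ring C]
    [Algebra K C] (h : IsSeparableKAlgebra K B) (e : B ≃ₐ[K] C) : IsSeparableKAlgebra K C := by
  intro L _ _
  have := h L
  exact (Algebra.TensorProduct.congr
    (AlgEquiv.refl (R := K) (A₁ := L)) e).toRingEquiv.isSemisimpleRing

theorem IsSeparableKAlgebra.isSemisimpleRing {B : Type u} [Ring B] [Algebra K B]
    (h : IsSeparableKAlgebra K B) : IsSemisimpleRing B :=
  have := h K
  (Algebra.TensorProduct.lid K B).toRingEquiv.isSemisimpleRing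

theorem IsSeparableKAlgebra.isIntegral {B : Type u} [Ring B] [Algebra K B]
    (h : IsSeparableKAlgebra K B) : Algebra.IsIntegral K B :=
  have := h (FractionRing (Polynomial K))
  .of_isArtinianRing_fractionRing_tensorProduct

/-- A separable algebra is finite-dimensional. -/
theorem IsSeparableKAlgebra.finite {B : Type u} [Ring B] [Algebra K B]
    (h : IsSeparableKAlgebra K B) : Module.Finite K B := by
  have := (h.baseChange (AlgebraicClosure K)).isIntegral
  have := h (AlgebraicClosure K)
  have := IsSemisimpleRing.finite_of_isIntegral (AlgebraicClosure K) (AlgebraicClosure K ⊗[K] B)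
  exact Module.Finite.of_finite_tensorProduct_of_faithfullyFlat (AlgebraicClosure K)

theorem IsSemisimpleRing.of_tensorProduct (R : Type*) [Ring R] [Algebra K R] [Module.Finite K R]
    (L : Type*) [Field L] [Algebra K L] [IsSemisimpleRing (L ⊗[K] R)] : IsSemisimpleRing R := by
  have := IsArtinianRing.of_finite K R
  rw [IsArtinianRing.isSemisimpleRing_iff_jacobson, eq_bot_iff]
  intro x hx
  let f : R →ₐ[K] R ⧸ Ring.jacobson R := Ideal.Quotient.mkₐ K _
  have hf : ∃ n : ℕ, LinearMap.ker f.toLinearMap ^ n = ⊥ := by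
    obtain ⟨n, hn⟩ := IsSemiprimaryRing.isNilpotent (R := R)
    have hle : LinearMap.ker f.toLinearMap ≤ (Ring.jacobson R).restrictScalars K :=
      fun x hx => Ideal.Quotient.eq_zero_iff_mem.mp hx
    have key (k : ℕ) : LinearMap.ker f.toLinearMap ^ k ≤
        (Ring.jacobson R ^ k).restrictScalars K := by
      induction k with
      | zero => simp [Submodule.pow_zero]
      | succ k ih =>
        rw [pow_succ, Submodule.mul_le]
        intro a ha b hb
        rw [Submodule.pow_succ]
        exact Ideal.mul_mem_mul (ih ha) (hle hb)
    exact ⟨n, eq_bot_iff.mpr ((key n).trans (by rw [hn]; rfl))⟩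
  have := (Algebra.TensorProduct.map (AlgHom.id K L) f).ker_le_jacobson
    (f.exists_ker_lTensor_pow_eq_bot L hf) (x := 1 ⊗ₜ x) <| by
      simp [f, Ideal.Quotient.eq_zero_iff_mem.mpr hx]
  rw [Ideal.jacobson_bot, IsSemisimpleRing.jacobson_eq_bot, Ideal.mem_bot] at this
  exact (map_eq_zero_iff (Algebra.TensorProduct.includeRight : R →ₐ[K] L ⊗[K] R)
    (Algebra.TensorProduct.includeRight_injective (algebraMap K L).injective)).mp this

theorem isSemisimpleRing_tensorProduct_pi_matrix (L B : Type*) [Field L] [Algebra K L] [Ring B]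
    [Algebra K B] [IsSemisimpleRing (L ⊗[K] B)] {n : ℕ} (d : Fin n → ℕ) :
    IsSemisimpleRing (B ⊗[K] (∀ i, Matrix (Fin (d i)) (Fin (d i)) L)) := by
  have := (Algebra.TensorProduct.comm K L B).toRingEquiv.isSemisimpleRing
  have (i : Fin n) : IsSemisimpleRing (B ⊗[K] Matrix (Fin (d i)) (Fin (d i)) L) :=
    (((matrixEquivTensor (Fin (d i)) K (B ⊗[K] L)).trans
      (Algebra.TensorProduct.assoc K K K B L (Matrix (Fin (d i)) (Fin (d i)) K))).trans
      (Algebra.TensorProduct.congr AlgEquiv.refl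
        (matrixEquivTensor (Fin (d i)) K L).symm)).toRingEquiv.isSemisimpleRing
  exact (Algebra.TensorProduct.piRight K K B
    fun i => Matrix (Fin (d i)) (Fin (d i)) L).symm.toRingEquiv.isSemisimpleRing

theorem IsSeparableKAlgebra.isSemisimpleRing_tensorProduct_of_isAlgClosed {A B : Type u} [Ring A]
    [Algebra K A] [Ring B] [Algebra K B] (hA : IsSeparableKAlgebra K A)
    (hB : IsSeparableKAlgebra K B) (L : Type u) [Field L] [Algebra K L] [IsAlgClosed L] :
    IsSemisimpleRing (L ⊗[K] (A ⊗[K] B)) := by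
  have := hA.finite
  have := hA L
  have := hB L
  obtain ⟨n, d, -, ⟨e⟩⟩ := IsSemisimpleRing.exists_algEquiv_pi_matrix_of_isAlgClosed L (L ⊗[K] A)
  have := isSemisimpleRing_tensorProduct_pi_matrix (K := K) L B d
  exact (((Algebra.TensorProduct.comm K B _).trans (Algebra.TensorProduct.congr
    (e.symm.restrictScalars K) AlgEquiv.refl)).trans
    (Algebra.TensorProduct.assoc K K K L A B)).toRingEquiv.isSemisimpleRing

theorem IsSeparableKAlgebra.tensorProduct {A B : Type u} [Ring A] [Algebra K A] [Ring B]
    [Algebra K B] (hA : IsSeparableKAlgebra K A) (hB : IsSeparableKAlgebra K B) :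
    IsSeparableKAlgebra K (A ⊗[K] B) := by
  intro L _ _
  have := hA.finite
  have := hB.finite
  let Ω := AlgebraicClosure L
  have := hA.isSemisimpleRing_tensorProduct_of_isAlgClosed hB Ω
  have := isSemisimpleRing_tensorProduct_baseChange (K := K) L Ω (A ⊗[K] B)
  exact IsSemisimpleRing.of_tensorProduct (K := L) (L ⊗[K] (A ⊗[K] B)) Ω

end Separable

/-- **Tensor product of Wedderburn algebras.** If `A` and `B` are Wedderburn `K`-algebras
then so is `A ⊗[K] B`, and its Jacobson radical is the sum of the images of
`J(A) ⊗[K] B` and `A ⊗[K] J(B)`. -/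
theorem wedderburn_tensor_product
    (K : Type u) [Field K] (A : Type u) [Ring A] [Algebra K A]
    (B : Type u) [Ring B] [Algebra K B]
    (hAnil : IsNilpotentSet (Ideal.jacobson (⊥ : Ideal A) : Set A))
    (hAsep : IsSeparableKAlgebra K (JacQuot A))
    (hBnil : IsNilpotentSet (Ideal.jacobson (⊥ : Ideal B) : Set B))
    (hBsep : IsSeparableKAlgebra K (JacQuot B)) :
    IsNilpotentSet
      (Ideal.jacobson (⊥ : Ideal (TensorProduct K A B)) : Set (TensorProduct K A B)) ∧
    IsSeparableKAlgebra K (JacQuot (TensorProduct K A B)) ∧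
    ∀ z : TensorProduct K A B,
      z ∈ Ideal.jacobson (⊥ : Ideal (TensorProduct K A B)) ↔
      z ∈ (LinearMap.range (LinearMap.rTensor B (Submodule.subtype
            (Submodule.restrictScalars K (Ideal.jacobson (⊥ : Ideal A))))) ⊔
          LinearMap.range (LinearMap.lTensor A (Submodule.subtype
            (Submodule.restrictScalars K (Ideal.jacobson (⊥ : Ideal B)))))) := by
  let πA := RingQuot.mkAlgHom K (jacRel A)
  let πB := RingQuot.mkAlgHom K (jacRel B)
  have hπA : ∃ n : ℕ, LinearMap.ker πA.toLinearMap ^ n = ⊥ :=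
    ker_mkAlgHom_jacRel (K := K) (A := A) ▸ IsNilpotentSet.exists_pow_eq_bot hAnil
  have hπB : ∃ n : ℕ, LinearMap.ker πB.toLinearMap ^ n = ⊥ :=
    ker_mkAlgHom_jacRel (K := K) (A := B) ▸ IsNilpotentSet.exists_pow_eq_bot hBnil
  have hsA : Function.Surjective πA := RingQuot.mkAlgHom_surjective K (jacRel A)
  have hsB : Function.Surjective πB := RingQuot.mkAlgHom_surjective K (jacRel B)
  let f := Algebra.TensorProduct.map πA πB
  have hs : Function.Surjective f := TensorProduct.map_surjective hsA hsB
  have hf : ∃ n : ℕ, LinearMap.ker f.toLinearMap ^ n = ⊥ := by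
    have : f = (Algebra.TensorProduct.map (AlgHom.id K (JacQuot A)) πB).comp
        (Algebra.TensorProduct.map πA (AlgHom.id K B)) := by
      ext <;> simp [f]
    rw [this]
    exact AlgHom.exists_ker_comp_pow_eq_bot _ _ (πA.exists_ker_rTensor_pow_eq_bot B hπA)
      (πB.exists_ker_lTensor_pow_eq_bot (JacQuot A) hπB)
  have hsep := hAsep.tensorProduct hBsep
  have := hsep.isSemisimpleRing
  have hJ (z : A ⊗[K] B) : z ∈ Ideal.jacobson (⊥ : Ideal (A ⊗[K] B)) ↔ f z = 0 :=
    f.mem_jacobson_iff_of_isSemisimpleRing hs hf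
  refine ⟨?_, ?_, fun z => ?_⟩
  · obtain ⟨n, hn⟩ := hf
    have hJker : (Ideal.jacobson (⊥ : Ideal (A ⊗[K] B)) : Set (A ⊗[K] B)) =
        LinearMap.ker f.toLinearMap := Set.ext hJ
    rw [hJker]
    exact Submodule.isNilpotentSet_of_pow_eq_bot hn
  · obtain ⟨e⟩ := nonempty_jacQuot_algEquiv f hs hJ
    exact hsep.of_algEquiv e.symm
  · have hker := TensorProduct.map_ker (LinearMap.exact_subtype_ker_map πA.toLinearMap) hsA
      (LinearMap.exact_subtype_ker_map πB.toLinearMap) hsB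
    rw [ker_mkAlgHom_jacRel, ker_mkAlgHom_jacRel] at hker
    rw [hJ, sup_comm, ← hker]
    rfl
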